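/- With K, 𝔟, ω, ℓ, α_i, β_i, Q as in the context, set σ := σ((0,1),(α_{ℓ−1},β_{ℓ−1})), u₁ := (−β_{ℓ−1},α_{ℓ−1}), u₂ := (1,0), I(h₁,h₂) := ∫_{σ(h)} e^{−Q(x₁,x₂)} dx₁dx₂ where σ(h) := {x ∈ ℝ² : ⟨x,u₁⟩ ≥ −h₁, ⟨x,u₂⟩ ≥ −h₂}, ε := α_{ℓ−1}ω + β_{ℓ−1}, ε′ := α_{ℓ−1}ω′ + β_{ℓ−1}, and P(x₁,x₂) := (N(𝔟)/α_{ℓ−1}²)·(x₂² + (ε+ε′)x₁x₂ + x₁²). For −2 ≤ i ≤ ℓ−1 let M_i(x₁,x₂) := (−1)^{i+1}·((β_iα_{ℓ−1} − α_iβ_{ℓ−1})x₂ + α_ix₁). Then for every integer k ≥ 0: [ −a₀·α_{ℓ−1}·P₁(∂_{h₁},∂_{h₂})·∂_{h₁}∂_{h₂} − ∂_{h₁}·P₂(∂_{h₁},∂_{h₂}) + ∂_{h₂}·P₃(∂_{h₁},∂_{h₂}) ] applied to I, evaluated at (h₁,h₂) = (0,0) — where P₁(x₁,x₂) := R_k(M_{−2}(x₁,x₂),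 M₀(x₁,x₂)), P₂(x₁,x₂) := M₀(x₁,x₂)^{2k+1}, P₃(x₁,x₂) := M_{ℓ−2}(x₁,x₂)^{2k+1} — equals (1/α_{ℓ−1})·Σ_{i=0}^{2k} (−1)^{i+1}·binom(2k+1,i+1)·((a₀α_{ℓ−1}+β_{ℓ−1})^{i+1} + α_{ℓ−2}^{i+1})·[∂_{h₂}ⁱ∂_{h₁}^{2k−i} e^{−P(h₁,h₂)}]|_{(h₁,h₂)=(0,0)} + (2/α_{ℓ−1})·∫₀^∞ [∂_{x₁}^{2k+1} e^{−P(−x₁,x₂)}]|_{x₁=0} dx₂. -/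

import Mathlib

open NumberField
open scoped nonZeroDivisors

noncomputable section

/-- first-coordinate partial derivative of a function on `ℝ × ℝ`. -/
def pd1 (f : ℝ × ℝ → ℝ) : ℝ × ℝ → ℝ := fun p => deriv (fun x => f (x, p.2)) p.1

/-- second-coordinate partial derivative of a function on `ℝ × ℝ`. -/
def pd2 (f : ℝ × ℝ → ℝ) : ℝ × ℝ → ℝ := fun p => deriv (fun y => f (p.1, y)) p.2

/-- The shifted cone `σ(h) = {x : ⟨x,u₁⟩ ≥ −h₁, ⟨x,u₂⟩ ≥ −h₂}`. -/
def sigmaSet (u₁ u₂ : ℤ × ℤ) (h : ℝ × ℝ) : Set (ℝ × ℝ) :=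
  {x : ℝ × ℝ | -h.1 ≤ x.1 * (u₁.1 : ℝ) + x.2 * (u₁.2 : ℝ) ∧
    -h.2 ≤ x.1 * (u₂.1 : ℝ) + x.2 * (u₂.2 : ℝ)}

/-- Application of a polynomial in `(∂_{h₁}, ∂_{h₂})` to a smooth function,
evaluated at `(0,0)`. -/
def applyDiffAt0 (P : MvPolynomial (Fin 2) ℝ) (g : ℝ × ℝ → ℝ) : ℝ :=
  ∑ d ∈ P.support, P.coeff d * (pd1^[d 0] (pd2^[d 1] g)) (0, 0)

/-- The linear form `M_j = (−1)^{j+1}·((β_j·α_{ℓ−1} − α_j·β_{ℓ−1})·x₂ + α_j·x₁)`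
as a polynomial over `ℝ`; here `L = ℓ−1`. -/
def MiPoly (αv βv : ℤ → ℤ) (L j : ℤ) : MvPolynomial (Fin 2) ℝ :=
  MvPolynomial.C ((-1 : ℝ) ^ (j + 1) * ((αv j : ℤ) : ℝ)) * MvPolynomial.X 0
  + MvPolynomial.C ((-1 : ℝ) ^ (j + 1) * ((βv j * αv L - αv j * βv L : ℤ) : ℝ)) *
      MvPolynomial.X 1

open MvPolynomial in
lemma hasDerivAt_eval0 (p : MvPolynomial (Fin 2) ℝ) (x y : ℝ) :
    HasDerivAt (fun x => eval ![x, y] p) (eval ![x, y] (pderiv 0 p)) x := by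
  induction p using MvPolynomial.induction_on with
  | C a => simpa using hasDerivAt_const x a
  | add p q hp hq => simpa using hp.fun_add hq
  | mul_X p i hp =>
    fin_cases i
    · simpa [Derivation.leibniz, pderiv_X_self, mul_comm, add_comm] using hp.fun_mul (hasDerivAt_id' x)
    · simpa [Derivation.leibniz, pderiv_X_of_ne, mul_comm] using hp.mul_const y

open MvPolynomial in
lemma hasDerivAt_eval1 (p : MvPolynomial (Fin 2) ℝ) (x y : ℝ) :
    HasDerivAt (fun y => eval ![x, y] p) (eval ![x, y] (pderiv 1 p)) y := by
  induction p using MvPolynomial.induction_on with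
  | C a => simpa using hasDerivAt_const y a
  | add p q hp hq => simpa using hp.fun_add hq
  | mul_X p i hp =>
    fin_cases i
    · simpa [Derivation.leibniz, pderiv_X_of_ne, mul_comm] using hp.mul_const x
    · simpa [Derivation.leibniz, pderiv_X_self, mul_comm, add_comm] using hp.fun_mul (hasDerivAt_id' y)

/-- `p · exp(-P)`. -/
def FF (c t : ℝ) (p : MvPolynomial (Fin 2) ℝ) (x y : ℝ) : ℝ :=
  MvPolynomial.eval ![x, y] p * Real.exp (-(c * (y ^ 2 + t * x * y + x ^ 2)))

open MvPolynomial in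
def DD1 (c t : ℝ) (p : MvPolynomial (Fin 2) ℝ) : MvPolynomial (Fin 2) ℝ :=
  pderiv 0 p - (C (2 * c) * X 0 + C (c * t) * X 1) * p

open MvPolynomial in
def DD2 (c t : ℝ) (p : MvPolynomial (Fin 2) ℝ) : MvPolynomial (Fin 2) ℝ :=
  pderiv 1 p - (C (2 * c) * X 1 + C (c * t) * X 0) * p

lemma hasDerivAt_FF1 (c t : ℝ) (p) (x y : ℝ) :
    HasDerivAt (fun x => FF c t p x y) (FF c t (DD1 c t p) x y) x := by
  have h : HasDerivAt (fun x : ℝ => (-(c * (y ^ 2 + t * x * y + x ^ 2))))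
      (-(c * (t * y + 2 * x))) x := by
    have := ((((((hasDerivAt_id' x).const_mul t).mul_const y).const_add (y^2)).fun_add
      (hasDerivAt_pow 2 x)).const_mul c).fun_neg
    exact this.congr_deriv (by norm_num)
  refine ((hasDerivAt_eval0 p x y).fun_mul h.exp).congr_deriv ?_
  simp only [FF, DD1, map_sub, map_add, map_mul, MvPolynomial.eval_C, MvPolynomial.eval_X, Matrix.cons_val_zero, Matrix.cons_val_one]
  ring

lemma hasDerivAt_FF2 (c t : ℝ) (p) (x y : ℝ) :
    HasDerivAt (fun y => FF c t p x y) (FF c t (DD2 c t p) x y) y := by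
  have h : HasDerivAt (fun y : ℝ => (-(c * (y ^ 2 + t * x * y + x ^ 2))))
      (-(c * (2 * y + t * x))) y := by
    have := ((((hasDerivAt_pow 2 y).fun_add ((hasDerivAt_id' y).const_mul (t * x))).add_const
      (x ^ 2)).const_mul c).fun_neg
    exact this.congr_deriv (by norm_num)
  refine ((hasDerivAt_eval1 p x y).fun_mul h.exp).congr_deriv ?_
  simp only [FF, DD2, map_sub, map_add, map_mul, MvPolynomial.eval_C, MvPolynomial.eval_X, Matrix.cons_val_zero, Matrix.cons_val_one]
  ring

lemma DD_comm (c t : ℝ) (p) : DD1 c t (DD2 c t p) = DD2 c t (DD1 c t p) := by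
  have h : MvPolynomial.pderiv (R := ℝ) (0 : Fin 2) (MvPolynomial.pderiv 1 p)
      = MvPolynomial.pderiv 1 (MvPolynomial.pderiv 0 p) := by
    induction p using MvPolynomial.induction_on with
    | C a => simp
    | add p q hp hq => simp [hp, hq]
    | mul_X p i hp =>
      fin_cases i <;> simp [Derivation.leibniz, MvPolynomial.pderiv_X, hp, add_comm]
  simp [DD1, DD2, Derivation.leibniz, MvPolynomial.pderiv_X, h]
  ring

lemma FF_bound (c t : ℝ) (hc : 0 < c) (ht : 0 ≤ t) (p) : ∀ R m : ℝ, 0 ≤ R → 0 ≤ m → ∃ K : ℝ, 0 ≤ K ∧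
    ∀ x y : ℝ, |y| ≤ R → |FF c t p x y| ≤ K * Real.exp (-(m * |x|)) := by
  induction p using MvPolynomial.induction_on with
  | C a =>
    intro R m hR hm
    refine ⟨|a| * Real.exp ((c * t * R + m) ^ 2 / (4 * c)), by positivity, fun x y hy => ?_⟩
    simp only [FF, MvPolynomial.eval_C, abs_mul, Real.abs_exp, mul_assoc |a|, ← Real.exp_add]
    gcongr
    have h1 : x * y ≥ - (|x| * R) := by
      have := neg_abs_le (x * y)
      rw [abs_mul] at this
      have := mul_le_mul_of_nonneg_left hy (abs_nonneg x)
      linarith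
    have h2 : c * t * (x * y) ≥ c * t * (- (|x| * R)) := mul_le_mul_of_nonneg_left h1 (by positivity)
    have h3 : (c * t * R + m) ^ 2 / (4 * c) ≥ (c * t * R + m) * |x| - c * |x| ^ 2 := by
      rw [ge_iff_le, le_div_iff₀ (by positivity)]
      nlinarith [sq_nonneg (c * t * R + m - 2 * c * |x|)]
    have h4 := sq_abs x
    have h5 : 0 ≤ c * y ^ 2 := by positivity
    rw [h4] at h3
    nlinarith
  | add p q hp hq =>
    intro R m hR hm
    obtain ⟨K, hK, h⟩ := hp R m hR hm
    obtain ⟨K', hK', h'⟩ := hq R m hR hm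
    refine ⟨K + K', by positivity, fun x y hy => ?_⟩
    have : FF c t (p + q) x y = FF c t p x y + FF c t q x y := by simp [FF, add_mul]
    rw [this, add_mul]
    exact (abs_add_le _ _).trans (add_le_add (h x y hy) (h' x y hy))
  | mul_X p i hp =>
    intro R m hR hm
    fin_cases i
    · obtain ⟨K, hK, h⟩ := hp R (m + 1) hR (by positivity)
      refine ⟨K, hK, fun x y hy => ?_⟩
      have e : FF c t (p * MvPolynomial.X 0) x y = x * FF c t p x y := by simp [FF]; ring
      show |FF c t (p * MvPolynomial.X 0) x y| ≤ _
      rw [e, abs_mul]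
      have : |x| ≤ Real.exp |x| := by linarith [Real.add_one_le_exp |x|]
      calc |x| * |FF c t p x y| ≤ Real.exp |x| * (K * Real.exp (-((m + 1) * |x|))) := by
            gcongr; exact h x y hy
        _ = K * (Real.exp |x| * Real.exp (-((m + 1) * |x|))) := by ring
        _ = _ := by rw [← Real.exp_add]; congr 2; ring
    · obtain ⟨K, hK, h⟩ := hp R m hR hm
      refine ⟨R * K, by positivity, fun x y hy => ?_⟩
      have e : FF c t (p * MvPolynomial.X 1) x y = y * FF c t p x y := by simp [FF]; ring
      show |FF c t (p * MvPolynomial.X 1) x y| ≤ _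
      rw [e, abs_mul, mul_assoc]
      gcongr
      exact h x y hy

lemma exp_abs_le (x : ℝ) : Real.exp (-(1 * |x|)) ≤ 2 * (1 + x ^ 2)⁻¹ := by
  have := Real.quadratic_le_exp_of_nonneg (abs_nonneg x)
  rw [sq_abs] at this
  rw [one_mul, Real.exp_neg, ← div_eq_mul_inv, le_div_iff₀ (by positivity),
    inv_mul_le_iff₀ (Real.exp_pos _)]
  nlinarith [abs_nonneg x]

lemma FF_bound' (c t : ℝ) (hc : 0 < c) (ht : 0 ≤ t) (p) (R : ℝ) (hR : 0 ≤ R) : ∃ K : ℝ, 0 ≤ K ∧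
    ∀ x y : ℝ, |y| ≤ R → |FF c t p x y| ≤ K * (1 + x ^ 2)⁻¹ := by
  obtain ⟨K, hK, h⟩ := FF_bound c t hc ht p R 1 hR (by norm_num)
  refine ⟨K * 2, by positivity, fun x y hy => (h x y hy).trans ?_⟩
  rw [mul_assoc]
  gcongr
  exact exp_abs_le x

lemma FF_cont (c t : ℝ) (p) : Continuous (fun z : ℝ × ℝ => FF c t p z.1 z.2) := by
  unfold FF
  refine Continuous.mul ?_ (by fun_prop)
  refine (MvPolynomial.continuous_eval p).comp ?_
  fun_prop

def GG (c t : ℝ) (p : MvPolynomial (Fin 2) ℝ) (h : ℝ × ℝ) : ℝ := ∫ x in Set.Iic h.1, FF c t p x h.2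

lemma FF_integrable (c t : ℝ) (hc : 0 < c) (ht : 0 ≤ t) (p) (y : ℝ) :
    MeasureTheory.Integrable (fun x => FF c t p x y) := by
  obtain ⟨K, hK, h⟩ := FF_bound' c t hc ht p |y| (abs_nonneg _)
  refine (integrable_inv_one_add_sq.const_mul K).mono' ?_ (Filter.Eventually.of_forall fun x => h x y le_rfl)
  exact ((FF_cont c t p).comp (by fun_prop : Continuous fun x : ℝ => (x, y))).aestronglyMeasurable

lemma hasDerivAt_GG2 (c t : ℝ) (hc : 0 < c) (ht : 0 ≤ t) (p) (h : ℝ × ℝ) :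
    HasDerivAt (fun y => GG c t p (h.1, y)) (GG c t (DD2 c t p) h) h.2 := by
  obtain ⟨K, hK, hb⟩ := FF_bound' c t hc ht (DD2 c t p) (|h.2| + 1) (by positivity)
  have := hasDerivAt_integral_of_dominated_loc_of_deriv_le
    (μ := MeasureTheory.volume.restrict (Set.Iic h.1)) (F := fun y x => FF c t p x y)
    (F' := fun y x => FF c t (DD2 c t p) x y) (x₀ := h.2) (s := Metric.ball h.2 1)
    (bound := fun x => K * (1 + x ^ 2)⁻¹) (Metric.ball_mem_nhds _ one_pos)
    (Filter.Eventually.of_forall fun y => (FF_integrable c t hc ht p y).aestronglyMeasurable.restrict)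
    (FF_integrable c t hc ht p h.2).restrict
    (FF_integrable c t hc ht _ h.2).aestronglyMeasurable.restrict
    (Filter.Eventually.of_forall fun x y hy => hb x y (by
      rw [Metric.mem_ball, Real.dist_eq] at hy
      have := abs_sub_abs_le_abs_sub y h.2
      linarith))
    (integrable_inv_one_add_sq.const_mul K).restrict
    (Filter.Eventually.of_forall fun x y _ => hasDerivAt_FF2 c t p x y)
  exact this.2

lemma hasDerivAt_Iic (f : ℝ → ℝ) (hf : Continuous f) (b : ℝ)
    (hi : ∀ b, MeasureTheory.IntegrableOn f (Set.Iic b)) :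
    HasDerivAt (fun u => ∫ x in Set.Iic u, f x) (f b) b := by
  have : (fun u => ∫ x in Set.Iic u, f x) = fun u => (∫ x in Set.Iic b, f x) + ∫ x in b..u, f x := by
    ext u
    rw [← intervalIntegral.integral_Iic_sub_Iic (hi b) (hi u)]
    ring
  rw [this]
  exact (hf.integral_hasStrictDerivAt b b).hasDerivAt.const_add _

lemma pd1_GG (c t : ℝ) (hc : 0 < c) (ht : 0 ≤ t) (p) : pd1 (GG c t p) = fun h => FF c t p h.1 h.2 := by
  ext h
  have hcont : Continuous (fun x => FF c t p x h.2) :=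
    continuous_iff_continuousAt.2 fun x => (hasDerivAt_FF1 c t p x h.2).continuousAt
  have := hasDerivAt_Iic (fun x => FF c t p x h.2) hcont h.1
    (fun b => (FF_integrable c t hc ht p h.2).integrableOn)
  exact this.deriv

lemma pd2_GG (c t : ℝ) (hc : 0 < c) (ht : 0 ≤ t) (p) : pd2 (GG c t p) = GG c t (DD2 c t p) := by
  ext h
  exact (hasDerivAt_GG2 c t hc ht p h).deriv

lemma E_integrable (c t : ℝ) (hc : 0 < c) (ht : 0 ≤ t) (h : ℝ × ℝ) :
    MeasureTheory.IntegrableOn (fun z : ℝ × ℝ => FF c t 1 z.1 z.2) (Set.Iic h.1 ×ˢ Set.Iic h.2)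
      (MeasureTheory.volume.prod MeasureTheory.volume) := by
  -- one-variable bound: exp(-(c x²) + q |x|) ≤ K (1+x²)⁻¹
  have key : ∀ q : ℝ, 0 ≤ q → ∀ x : ℝ, Real.exp (-(c * x ^ 2) + q * |x|) ≤
      Real.exp ((q + 1) ^ 2 / (4 * c)) * (2 * (1 + x ^ 2)⁻¹) := by
    intro q hq x
    calc _ ≤ Real.exp ((q + 1) ^ 2 / (4 * c) + (-(1 * |x|))) := by
          rw [Real.exp_le_exp]
          have h3 : (q + 1) ^ 2 / (4 * c) ≥ (q + 1) * |x| - c * |x| ^ 2 := by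
            rw [ge_iff_le, le_div_iff₀ (by positivity)]
            nlinarith [sq_nonneg (q + 1 - 2 * c * |x|)]
          rw [sq_abs] at h3
          linarith
      _ ≤ _ := by
        rw [Real.exp_add]
        gcongr
        exact exp_abs_le x
  set q1 := c * t * |h.2|
  set q2 := c * t * |h.1|
  have hq1 : 0 ≤ q1 := by positivity
  have hq2 : 0 ≤ q2 := by positivity
  have hint := ((integrable_inv_one_add_sq.const_mul 2).const_mul
      (Real.exp ((q1 + 1) ^ 2 / (4 * c)))).mul_prod ((integrable_inv_one_add_sq.const_mul 2).const_mul
      (Real.exp ((q2 + 1) ^ 2 / (4 * c))))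
  refine MeasureTheory.Integrable.mono' (hint.restrict (s := Set.Iic h.1 ×ˢ Set.Iic h.2)) (FF_cont c t 1).aestronglyMeasurable ?_
  refine (MeasureTheory.ae_restrict_iff' (measurableSet_Iic.prod measurableSet_Iic)).2
    (Filter.Eventually.of_forall fun z hz => ?_)
  obtain ⟨h1, h2⟩ := hz
  simp only [Set.mem_Iic] at h1 h2
  refine le_trans ?_ (mul_le_mul (key q1 hq1 z.1) (key q2 hq2 z.2) (Real.exp_pos _).le (by positivity))
  rw [← Real.exp_add]
  simp only [FF, map_one, one_mul, Real.norm_eq_abs, Real.abs_exp]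
  gcongr
  have hx : z.1 * z.2 ≥ -(|h.1| * |z.2| + |h.2| * |z.1|) := by
    have a1 := le_abs_self h.1
    have a2 := le_abs_self h.2
    rcases le_total 0 z.1 with hz1 | hz1 <;> rcases le_total 0 z.2 with hz2 | hz2
    · have : 0 ≤ |h.1| * |z.2| := by positivity
      have : 0 ≤ |h.2| * |z.1| := by positivity
      nlinarith
    · have : 0 ≤ |h.2| * |z.1| := by positivity
      rw [abs_of_nonpos hz2]
      nlinarith
    · have : 0 ≤ |h.1| * |z.2| := by positivity
      rw [abs_of_nonpos hz1]
      nlinarith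
    · have : 0 ≤ |h.1| * |z.2| := by positivity
      have : 0 ≤ |h.2| * |z.1| := by positivity
      nlinarith
  have : c * t * (z.1 * z.2) ≥ c * t * (-(|h.1| * |z.2| + |h.2| * |z.1|)) :=
    mul_le_mul_of_nonneg_left hx (by positivity)
  simp only [q1, q2]
  nlinarith

def JJ (c t : ℝ) (h : ℝ × ℝ) : ℝ := ∫ z in Set.Iic h.1 ×ˢ Set.Iic h.2, FF c t 1 z.1 z.2

lemma JJ_eq (c t : ℝ) (hc : 0 < c) (ht : 0 ≤ t) (h : ℝ × ℝ) :
    JJ c t h = ∫ y in Set.Iic h.2, GG c t 1 (h.1, y) := by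
  have := E_integrable c t hc ht h
  rw [MeasureTheory.IntegrableOn, ← MeasureTheory.Measure.prod_restrict] at this
  rw [JJ, MeasureTheory.Measure.volume_eq_prod, ← MeasureTheory.Measure.prod_restrict,
    MeasureTheory.integral_prod_symm _ this]
  rfl

lemma GG_integrableOn (c t : ℝ) (hc : 0 < c) (ht : 0 ≤ t) (h : ℝ × ℝ) :
    MeasureTheory.IntegrableOn (fun y => GG c t 1 (h.1, y)) (Set.Iic h.2) := by
  have := E_integrable c t hc ht h
  rw [MeasureTheory.IntegrableOn, ← MeasureTheory.Measure.prod_restrict] at this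
  exact this.integral_prod_right

lemma pd2_JJ (c t : ℝ) (hc : 0 < c) (ht : 0 ≤ t) : pd2 (JJ c t) = GG c t 1 := by
  ext h
  have e : (fun y => JJ c t (h.1, y)) = fun u => ∫ y in Set.Iic u, GG c t 1 (h.1, y) := by
    ext y; exact JJ_eq c t hc ht (h.1, y)
  rw [pd2, e]
  refine (hasDerivAt_Iic (fun y => GG c t 1 (h.1, y)) ?_ h.2
    (fun b => GG_integrableOn c t hc ht (h.1, b))).deriv
  exact continuous_iff_continuousAt.2 fun y => (hasDerivAt_GG2 c t hc ht 1 (h.1, y)).continuousAt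

lemma FF_one_swap (c t x y : ℝ) : FF c t 1 x y = FF c t 1 y x := by
  simp only [FF, map_one]; congr 3; ring

lemma JJ_swap (c t : ℝ) : (JJ c t) ∘ Prod.swap = JJ c t := by
  ext h
  simp only [JJ, Function.comp, Prod.fst_swap, Prod.snd_swap]
  have := MeasureTheory.setIntegral_prod_swap (μ := (MeasureTheory.volume : MeasureTheory.Measure ℝ))
    (ν := (MeasureTheory.volume : MeasureTheory.Measure ℝ)) (Set.Iic h.1) (Set.Iic h.2)
    (fun z : ℝ × ℝ => FF c t 1 z.1 z.2)
  simp only [MeasureTheory.Measure.volume_eq_prod]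
  rw [← this]
  simp only [Prod.fst_swap, Prod.snd_swap]
  simp_rw [FF_one_swap c t]

lemma pd1_iter_swap (f : ℝ × ℝ → ℝ) (n : ℕ) : pd1^[n] (f ∘ Prod.swap) = (pd2^[n] f) ∘ Prod.swap := by
  induction n generalizing f with
  | zero => rfl
  | succ n ih => rw [Function.iterate_succ_apply, Function.iterate_succ_apply, ← ih]; rfl

lemma pd2_iter_swap (f : ℝ × ℝ → ℝ) (n : ℕ) : pd2^[n] (f ∘ Prod.swap) = (pd1^[n] f) ∘ Prod.swap := by
  induction n generalizing f with
  | zero => rfl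
  | succ n ih => rw [Function.iterate_succ_apply, Function.iterate_succ_apply, ← ih]; rfl

lemma pd1_FF (c t : ℝ) (p) (n : ℕ) : pd1^[n] (fun h => FF c t p h.1 h.2) =
    fun h => FF c t ((DD1 c t)^[n] p) h.1 h.2 := by
  induction n generalizing p with
  | zero => rfl
  | succ n ih =>
    rw [Function.iterate_succ_apply, Function.iterate_succ_apply, ← ih]
    congr 1
    ext h
    exact (hasDerivAt_FF1 c t p h.1 h.2).deriv

lemma pd2_FF (c t : ℝ) (p) (n : ℕ) : pd2^[n] (fun h => FF c t p h.1 h.2) =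
    fun h => FF c t ((DD2 c t)^[n] p) h.1 h.2 := by
  induction n generalizing p with
  | zero => rfl
  | succ n ih =>
    rw [Function.iterate_succ_apply, Function.iterate_succ_apply, ← ih]
    congr 1
    ext h
    exact (hasDerivAt_FF2 c t p h.1 h.2).deriv

lemma pd2_iter_GG (c t : ℝ) (hc : 0 < c) (ht : 0 ≤ t) (p) (n : ℕ) :
    pd2^[n] (GG c t p) = GG c t ((DD2 c t)^[n] p) := by
  induction n generalizing p with
  | zero => rfl
  | succ n ih =>
    rw [Function.iterate_succ_apply, Function.iterate_succ_apply, ← ih, pd2_GG c t hc ht]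

lemma mixed_JJ (c t : ℝ) (hc : 0 < c) (ht : 0 ≤ t) (m n : ℕ) :
    pd1^[m + 1] (pd2^[n + 1] (JJ c t)) = pd1^[m] (pd2^[n] (fun h => FF c t 1 h.1 h.2)) := by
  rw [Function.iterate_succ_apply, Function.iterate_succ_apply, pd2_JJ c t hc ht,
    pd2_iter_GG c t hc ht, pd1_GG c t hc ht, pd2_FF]

lemma pd_FF_comm (c t : ℝ) (p) (m n : ℕ) : pd1^[m] (pd2^[n] (fun h => FF c t p h.1 h.2)) =
    pd2^[n] (pd1^[m] (fun h => FF c t p h.1 h.2)) := by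
  rw [pd2_FF, pd1_FF, pd1_FF, pd2_FF]
  have : Function.Commute (DD1 c t) (DD2 c t) := fun p => DD_comm c t p
  rw [(this.iterate_iterate m n).eq]

lemma pd_FF_swap (c t : ℝ) (m n : ℕ) : pd1^[m] (pd2^[n] (fun h => FF c t 1 h.1 h.2)) (0, 0) =
    pd2^[m] (pd1^[n] (fun h => FF c t 1 h.1 h.2)) (0, 0) := by
  have : (fun h : ℝ × ℝ => FF c t 1 h.1 h.2) = (fun h => FF c t 1 h.1 h.2) ∘ Prod.swap := by
    ext h; exact FF_one_swap ..
  conv_lhs => rw [this, pd2_iter_swap, pd1_iter_swap]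
  rfl

lemma pure2_JJ (c t : ℝ) (hc : 0 < c) (ht : 0 ≤ t) (n : ℕ) :
    pd2^[n + 1] (JJ c t) (0, 0) = ∫ x in Set.Iic (0 : ℝ), FF c t ((DD2 c t)^[n] 1) x 0 := by
  rw [Function.iterate_succ_apply, pd2_JJ c t hc ht, pd2_iter_GG c t hc ht]; rfl

lemma pure1_JJ (c t : ℝ) (n : ℕ) : pd1^[n] (JJ c t) (0, 0) = pd2^[n] (JJ c t) (0, 0) := by
  conv_lhs => rw [← JJ_swap, pd1_iter_swap]
  rfl

lemma rhs_int (c t : ℝ) (n : ℕ) :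
    ∫ x₂ in Set.Ioi (0 : ℝ), (pd1^[n] (fun x : ℝ × ℝ => FF c t 1 (-x.1) x.2)) (0, x₂)
      = ∫ x in Set.Iic (0 : ℝ), FF c t ((DD2 c t)^[n] 1) x 0 := by
  have key : ∀ (f : ℝ × ℝ → ℝ), pd1^[n] (fun x : ℝ × ℝ => f (-x.2, x.1)) =
      fun x => (pd2^[n] f) (-x.2, x.1) := by
    induction n with
    | zero => intro f; rfl
    | succ n ih =>
      intro f
      rw [Function.iterate_succ_apply, Function.iterate_succ_apply, ← ih]; rfl
  have e : (fun x : ℝ × ℝ => FF c t 1 (-x.1) x.2) =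
      (fun x : ℝ × ℝ => (fun h : ℝ × ℝ => FF c t 1 h.1 h.2) (-x.2, x.1)) := by
    ext x; simp only [FF, map_one]; congr 3; ring
  rw [e, key (fun h : ℝ × ℝ => FF c t 1 h.1 h.2), pd2_FF]
  simpa using integral_comp_neg_Ioi (0 : ℝ) (fun x => FF c t ((DD2 c t)^[n] 1) x 0)

lemma pd1_smul (s : ℝ) (f : ℝ × ℝ → ℝ) (n : ℕ) : pd1^[n] (fun h => s * f h) = fun h => s * (pd1^[n] f) h := by
  induction n generalizing f with
  | zero => rfl
  | succ n ih =>
    rw [Function.iterate_succ_apply, Function.iterate_succ_apply, ← ih]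
    congr 1; ext h; simp [pd1, deriv_const_mul_field]

lemma pd2_smul (s : ℝ) (f : ℝ × ℝ → ℝ) (n : ℕ) : pd2^[n] (fun h => s * f h) = fun h => s * (pd2^[n] f) h := by
  induction n generalizing f with
  | zero => rfl
  | succ n ih =>
    rw [Function.iterate_succ_apply, Function.iterate_succ_apply, ← ih]
    congr 1; ext h; simp [pd2, deriv_const_mul_field]

/-- linear version of `applyDiffAt0` -/
lemma applyDiff_smul (P) (s : ℝ) (f : ℝ × ℝ → ℝ) :
    applyDiffAt0 P (fun h => s * f h) = s * applyDiffAt0 P f := by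
  simp only [applyDiffAt0, pd1_smul, pd2_smul, Finset.mul_sum]
  exact Finset.sum_congr rfl fun _ _ => by ring

lemma exists_lin (g : ℝ × ℝ → ℝ) : ∃ T : MvPolynomial (Fin 2) ℝ →ₗ[ℝ] ℝ,
    (∀ P, applyDiffAt0 P g = T P) ∧
    ∀ (s : ℝ) (m n : ℕ), T (MvPolynomial.C s * MvPolynomial.X 0 ^ m * MvPolynomial.X 1 ^ n)
      = s * (pd1^[m] (pd2^[n] g)) (0, 0) := by
  have hT := fun d : Fin 2 →₀ ℕ => (pd1^[d 0] (pd2^[d 1] g)) (0, 0)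
  let T : MvPolynomial (Fin 2) ℝ →ₗ[ℝ] ℝ := (MvPolynomial.basisMonomials (Fin 2) ℝ).constr ℝ
    (fun d : Fin 2 →₀ ℕ => (pd1^[d 0] (pd2^[d 1] g)) (0, 0))
  have hmon : ∀ d s, T (MvPolynomial.monomial d s) = s * (pd1^[d 0] (pd2^[d 1] g)) (0, 0) := by
    intro d s
    have : MvPolynomial.monomial d s = s • MvPolynomial.basisMonomials (Fin 2) ℝ d := by
      simp [MvPolynomial.smul_monomial]
    rw [this, map_smul, Module.Basis.constr_basis, smul_eq_mul]
  refine ⟨T, fun P => ?_, fun s m n => ?_⟩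
  · conv_rhs => rw [MvPolynomial.as_sum P, map_sum]
    simp only [hmon]; rfl
  · have : (MvPolynomial.C s * MvPolynomial.X 0 ^ m * MvPolynomial.X 1 ^ n : MvPolynomial (Fin 2) ℝ)
      = MvPolynomial.monomial (Finsupp.single 0 m + Finsupp.single 1 n) s := by
      rw [MvPolynomial.X_pow_eq_monomial, MvPolynomial.X_pow_eq_monomial, MvPolynomial.C_mul_monomial,
        MvPolynomial.monomial_mul]
      simp
    rw [this, hmon]
    simp

open MvPolynomial in
lemma poly_expand (u v : ℝ) (k : ℕ) :
    (-(X 0 * (C u * X 1 - X 0) ^ (2 * k + 1)) + X 1 * (X 1 - C v * X 0) ^ (2 * k + 1)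
      : MvPolynomial (Fin 2) ℝ) =
    (∑ i ∈ Finset.range (2 * k + 1),
      (C ((-1) ^ (i + 1) * ((2 * k + 1).choose (i + 1) : ℝ) * u ^ (i + 1)) * X 0 ^ (2 * k - i + 1) * X 1 ^ (i + 1)
       + C ((-1) ^ (i + 1) * ((2 * k + 1).choose (i + 1) : ℝ) * v ^ (i + 1)) * X 0 ^ (i + 1) * X 1 ^ (2 * k - i + 1)))
     + C 1 * X 0 ^ (2 * k + 2) * X 1 ^ 0 + C 1 * X 0 ^ 0 * X 1 ^ (2 * k + 2) := by
  have key : ∀ (a b : MvPolynomial (Fin 2) ℝ) (u : ℝ), a * (a - C u * b) ^ (2 * k + 1) =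
      (∑ i ∈ Finset.range (2 * k + 1),
        C ((-1) ^ (i + 1) * ((2 * k + 1).choose (i + 1) : ℝ) * u ^ (i + 1)) * a ^ (2 * k - i + 1) * b ^ (i + 1))
      + a ^ (2 * k + 2) := by
    intro a b u
    have : a - C u * b = (-1) * C u * b + a := by ring
    rw [this, add_pow, Finset.sum_range_succ', mul_add, Finset.mul_sum]
    congr 1
    · refine Finset.sum_congr rfl fun i hi => ?_
      have h : 2 * k + 1 - (i + 1) = 2 * k - i := by omega
      rw [h]
      simp only [C_mul, C_pow, C_neg, C_1, mul_pow, map_natCast]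
      ring
    · simp; ring
  have h1 : (-(X 0 * (C u * X 1 - X 0) ^ (2 * k + 1)) : MvPolynomial (Fin 2) ℝ) =
      X 0 * (X 0 - C u * X 1) ^ (2 * k + 1) := by
    have : (C u * X 1 - X 0 : MvPolynomial (Fin 2) ℝ) = -(X 0 - C u * X 1) := by ring
    rw [this, Odd.neg_pow ⟨k, rfl⟩]; ring
  rw [h1, key, key, Finset.sum_add_distrib]
  simp only [C_1]
  have : ∀ i ∈ Finset.range (2 * k + 1), (C ((-1) ^ (i + 1) * ((2 * k + 1).choose (i + 1) : ℝ) * v ^ (i + 1)) * X 1 ^ (2 * k - i + 1) * X 0 ^ (i + 1) : MvPolynomial (Fin 2) ℝ) = C ((-1) ^ (i + 1) * ((2 * k + 1).choose (i + 1) : ℝ) * v ^ (i + 1)) * X 0 ^ (i + 1) * X 1 ^ (2 * k - i + 1) := fun i _ => by ring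
  rw [Finset.sum_congr rfl this]
  ring

lemma main_JJ (c t : ℝ) (hc : 0 < c) (ht : 0 ≤ t) (u v : ℝ) (k : ℕ) :
    applyDiffAt0 (-(MvPolynomial.X 0 * (MvPolynomial.C u * MvPolynomial.X 1 - MvPolynomial.X 0) ^ (2 * k + 1)) + MvPolynomial.X 1 * (MvPolynomial.X 1 - MvPolynomial.C v * MvPolynomial.X 0) ^ (2 * k + 1)) (JJ c t)
    = (∑ i ∈ Finset.range (2 * k + 1), (-1 : ℝ) ^ (i + 1) *
          ((2 * k + 1).choose (i + 1) : ℝ) * (u ^ (i + 1) + v ^ (i + 1)) *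
          (pd2^[i] (pd1^[2 * k - i] (fun h : ℝ × ℝ => FF c t 1 h.1 h.2)) (0, 0)))
      + 2 * ∫ x₂ in Set.Ioi (0 : ℝ), (pd1^[2 * k + 1] (fun x : ℝ × ℝ => FF c t 1 (-x.1) x.2)) (0, x₂) := by
  obtain ⟨T, hT, hTm⟩ := exists_lin (JJ c t)
  rw [hT, poly_expand, map_add, map_add, map_sum, rhs_int]
  simp only [map_add, hTm, mixed_JJ c t hc ht]
  rw [Function.iterate_zero, id, Function.iterate_zero, id, pure1_JJ, pure2_JJ c t hc ht (2 * k + 1)]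
  have : ∀ i ∈ Finset.range (2 * k + 1), 
      ((-1) ^ (i + 1) * ((2 * k + 1).choose (i + 1) : ℝ) * u ^ (i + 1)) *
        (pd1^[2 * k - i] (pd2^[i] (fun h : ℝ × ℝ => FF c t 1 h.1 h.2)) (0, 0)) +
      ((-1) ^ (i + 1) * ((2 * k + 1).choose (i + 1) : ℝ) * v ^ (i + 1)) *
        (pd1^[i] (pd2^[2 * k - i] (fun h : ℝ × ℝ => FF c t 1 h.1 h.2)) (0, 0)) = 
      (-1 : ℝ) ^ (i + 1) *
          ((2 * k + 1).choose (i + 1) : ℝ) * (u ^ (i + 1) + v ^ (i + 1)) *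
          (pd2^[i] (pd1^[2 * k - i] (fun h : ℝ × ℝ => FF c t 1 h.1 h.2)) (0, 0)) := by
    intro i _
    rw [pd_FF_swap c t i, pd_FF_comm]
    ring
  rw [Finset.sum_congr rfl this]
  ring

lemma change_var (A B : ℤ) (hA : 0 < A) (N w w' : ℝ)
    (hn : ((A : ℝ) * w + B) * (A * w' + B) = 1) (h : ℝ × ℝ) :
    ∫ x in sigmaSet (-B, A) (1, 0) h, Real.exp (-(N * (x.1 * w + x.2) * (x.1 * w' + x.2))) =
      (1 / (A : ℝ)) * JJ (N / (A : ℝ) ^ 2) (A * w + B + (A * w' + B)) h := by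
  have hA' : (0 : ℝ) < A := by exact_mod_cast hA
  set L : ℝ × ℝ →ₗ[ℝ] ℝ × ℝ := Matrix.toLin (Module.Basis.finTwoProd ℝ) (Module.Basis.finTwoProd ℝ)
    !![(B : ℝ), -A; -1, 0] with hL
  have hLa : ∀ x, L x = (B * x.1 - A * x.2, -x.1) := by
    intro x; rw [hL, Matrix.toLin_finTwoProd_apply]; ext <;> simp; ring
  have hdet : LinearMap.det L = -A := by
    rw [hL, LinearMap.det_toLin, Matrix.det_fin_two_of]; ring
  have hmap := MeasureTheory.Measure.map_linearMap_addHaar_eq_smul_addHaar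
    (MeasureTheory.volume : MeasureTheory.Measure (ℝ × ℝ)) (f := L) (by rw [hdet]; simpa using hA.ne')
  have hS : MeasurableSet (Set.Iic h.1 ×ˢ Set.Iic h.2 : Set (ℝ × ℝ)) := measurableSet_Iic.prod measurableSet_Iic
  have hLc : Continuous L := L.continuous_of_finiteDimensional
  have hpre : sigmaSet (-B, A) (1, 0) h = L ⁻¹' (Set.Iic h.1 ×ˢ Set.Iic h.2) := by
    ext x
    simp only [sigmaSet, Set.mem_ofPred_eq, Set.mem_preimage, hLa, Set.mem_prod, Set.mem_Iic]
    push_cast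
    constructor <;> rintro ⟨h1, h2⟩ <;> constructor <;> linarith
  have hF : ∀ x : ℝ × ℝ, Real.exp (-(N * (x.1 * w + x.2) * (x.1 * w' + x.2))) =
      FF (N / (A : ℝ) ^ 2) (A * w + B + (A * w' + B)) 1 (L x).1 (L x).2 := by
    intro x
    simp only [FF, hLa, map_one, one_mul]
    congr 2
    field_simp
    linear_combination (N * x.1 ^ 2) * hn
  simp_rw [hF]
  rw [hpre, ← MeasureTheory.setIntegral_map hS (f := fun z : ℝ × ℝ => FF (N / (A : ℝ) ^ 2) (A * w + B + (A * w' + B)) 1 z.1 z.2)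
    (FF_cont _ _ _).aestronglyMeasurable hLc.aemeasurable, hmap, MeasureTheory.Measure.restrict_smul,
    MeasureTheory.integral_smul_measure, hdet, JJ, smul_eq_mul]
  congr 1
  rw [ENNReal.toReal_ofReal (by positivity), abs_inv, abs_neg, abs_of_pos hA', one_div]

/- STATEMENT 14: the `ℛ`-operator part of the zeta expression, rewritten through the
function `P(x₁,x₂) = (N(𝔟)/α_{ℓ−1}²)(x₂² + (ε+ε′)x₁x₂ + x₁²)`. -/
theorem stmt_14
    -- K is a real quadratic field with nontrivial automorphism `conj` and real embedding `ι`
    (K : Type) [Field K] [NumberField K] (hdeg : Module.finrank ℚ K = 2)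
    (ι : K →+* ℝ) (conj : K ≃ₐ[ℚ] K) (hconj : conj ≠ AlgEquiv.refl)
    -- 𝔟 is a nonzero integral ideal with 𝔟⁻¹ = ℤ + ℤω
    (𝔟 : Ideal (𝓞 K)) (h𝔟 : 𝔟 ≠ 0) (ω : K)
    (hinv : ∀ x : K, x ∈ ((𝔟 : FractionalIdeal (𝓞 K)⁰ K))⁻¹ ↔
      ∃ c d : ℤ, x = (c : K) + (d : K) * ω)
    (hω1 : 1 < ι ω) (hω'gt : -1 < ι (conj ω)) (hω'lt : ι (conj ω) < 0)
    -- purely periodic continued fraction expansion ω = [[a₀,…,a_{r−1}]]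
    (r : ℕ) (hr : 0 < r) (a : ℕ → ℤ) (hapos : ∀ i, 1 ≤ a i) (haper : ∀ i, a (i + r) = a i)
    (w : ℕ → K) (hw0 : w 0 = ω) (hwgt : ∀ i, 1 < ι (w i))
    (hwrec : ∀ i, w i = (a i : K) + (w (i + 1))⁻¹) (hwper : ∀ i, w (i + r) = w i)
    -- the even period
    (ℓ : ℕ) (hℓ : ℓ = if r % 2 = 0 then r else 2 * r)
    -- the sequences α, β (with α_{−2} = 1, β_{−2} = −a₀)
    (α β : ℤ → ℤ) (hαm2 : α (-2) = 1) (hαm1 : α (-1) = 0) (hα0 : α 0 = 1)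
    (hβm2 : β (-2) = -(a 0)) (hβm1 : β (-1) = 1) (hβ0 : β 0 = 0)
    (hαrec : ∀ i : ℕ, i < ℓ → α ((i : ℤ) + 1) = a (ℓ - 1 - i) * α (i : ℤ) + α ((i : ℤ) - 1))
    (hβrec : ∀ i : ℕ, i < ℓ → β ((i : ℤ) + 1) = a (ℓ - 1 - i) * β (i : ℤ) + β ((i : ℤ) - 1))
    (k : ℕ) :
    applyDiffAt0
      (-(MvPolynomial.C ((a 0 * α ((ℓ : ℤ) - 1) : ℤ) : ℝ)) *
          (∑ j ∈ Finset.range (2 * k + 1),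
            (MiPoly α β ((ℓ : ℤ) - 1) (-2)) ^ j * (MiPoly α β ((ℓ : ℤ) - 1) 0) ^ (2 * k - j)) *
          MvPolynomial.X 0 * MvPolynomial.X 1
        - MvPolynomial.X 0 * (MiPoly α β ((ℓ : ℤ) - 1) 0) ^ (2 * k + 1)
        + MvPolynomial.X 1 * (MiPoly α β ((ℓ : ℤ) - 1) ((ℓ : ℤ) - 2)) ^ (2 * k + 1))
      (fun h : ℝ × ℝ =>
        ∫ x in sigmaSet (-(β ((ℓ : ℤ) - 1)), α ((ℓ : ℤ) - 1)) (1, 0) h,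
          Real.exp (-((Ideal.absNorm 𝔟 : ℝ) * (x.1 * ι ω + x.2) * (x.1 * ι (conj ω) + x.2))))
    = (1 / ((α ((ℓ : ℤ) - 1) : ℤ) : ℝ)) *
        (∑ i ∈ Finset.range (2 * k + 1), (-1 : ℝ) ^ (i + 1) *
          ((2 * k + 1).choose (i + 1) : ℝ) *
          (((a 0 * α ((ℓ : ℤ) - 1) + β ((ℓ : ℤ) - 1) : ℤ) : ℝ) ^ (i + 1)
            + ((α ((ℓ : ℤ) - 2) : ℤ) : ℝ) ^ (i + 1)) *
          (pd2^[i] (pd1^[2 * k - i] (fun h : ℝ × ℝ =>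
            Real.exp (-((Ideal.absNorm 𝔟 : ℝ) / ((α ((ℓ : ℤ) - 1) : ℤ) : ℝ) ^ 2 *
              (h.2 ^ 2 + (((α ((ℓ : ℤ) - 1) : ℤ) : ℝ) * ι ω + ((β ((ℓ : ℤ) - 1) : ℤ) : ℝ)
                  + (((α ((ℓ : ℤ) - 1) : ℤ) : ℝ) * ι (conj ω) + ((β ((ℓ : ℤ) - 1) : ℤ) : ℝ)))
                  * h.1 * h.2
                + h.1 ^ 2))))) (0, 0)))
      + (2 / ((α ((ℓ : ℤ) - 1) : ℤ) : ℝ)) *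
          ∫ x₂ in Set.Ioi (0 : ℝ),
            (pd1^[2 * k + 1] (fun x : ℝ × ℝ =>
              Real.exp (-((Ideal.absNorm 𝔟 : ℝ) / ((α ((ℓ : ℤ) - 1) : ℤ) : ℝ) ^ 2 *
                (x.2 ^ 2 + (((α ((ℓ : ℤ) - 1) : ℤ) : ℝ) * ι ω + ((β ((ℓ : ℤ) - 1) : ℤ) : ℝ)
                    + (((α ((ℓ : ℤ) - 1) : ℤ) : ℝ) * ι (conj ω) + ((β ((ℓ : ℤ) - 1) : ℤ) : ℝ)))
                    * (-x.1) * x.2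
                  + (-x.1) ^ 2)))) ) (0, x₂) := by
  have hr2 : ℓ % 2 = 0 ∧ 2 ≤ ℓ ∧ ∃ q, ℓ = q * r := by
    split_ifs at hℓ with h
    · exact ⟨by omega, by omega, 1, by omega⟩
    · exact ⟨by omega, by omega, 2, by omega⟩
  obtain ⟨hev, hl2, q, hq⟩ := hr2
  have hwl : w ℓ = ω := by
    have : ∀ q : ℕ, w (q * r) = w 0 := by
      intro q
      induction q with
      | zero => simp
      | succ q ih => rw [Nat.succ_mul, hwper, ih]
    rw [hq, this, hw0]
  have hwne : ∀ i, w i ≠ 0 := by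
    intro i h
    have := hwgt i
    rw [h, map_zero] at this
    linarith
  have key : ∀ n : ℕ, n ≤ ℓ →
      (β ((n : ℤ) - 1) * α n - α ((n : ℤ) - 1) * β n = (-1) ^ n) ∧
      (1 ≤ α n ∧ 0 ≤ α ((n : ℤ) - 1) ∧ 0 ≤ β n ∧ 0 ≤ β ((n : ℤ) - 1)) ∧
      ((α n : K) * ω + β n = w (ℓ - n) * ((α ((n : ℤ) - 1) : K) * ω + β ((n : ℤ) - 1))) := by
    intro n
    induction n with
    | zero =>
      intro _
      simp [hαm1, hα0, hβm1, hβ0, hwl]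
    | succ n ih =>
      intro hn
      obtain ⟨h1, ⟨h2, h3, h4, h5⟩, h6⟩ := ih (by omega)
      have ea := hαrec n (by omega)
      have eb := hβrec n (by omega)
      have hap := hapos (ℓ - 1 - n)
      have e1 : ((n + 1 : ℕ) : ℤ) - 1 = n := by push_cast; ring
      have e2 : ((n + 1 : ℕ) : ℤ) = (n : ℤ) + 1 := by push_cast; ring
      rw [e1, e2, ea, eb]
      refine ⟨?_, ⟨by nlinarith, by linarith, by nlinarith, h4⟩, ?_⟩
      · rw [pow_succ, ← h1]; ring
      · have hw1 := hwrec (ℓ - (n + 1))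
        have e3 : ℓ - (n + 1) + 1 = ℓ - n := by omega
        have e4 : ℓ - (n + 1) = ℓ - 1 - n := by omega
        rw [e3] at hw1
        rw [hw1, e4, h6]
        have e5 : ((α ((n : ℤ) - 1) : K) * ω + β ((n : ℤ) - 1)) =
          (w (ℓ - n))⁻¹ * ((α n : K) * ω + β n) := by
          rw [h6, inv_mul_cancel_left₀ (hwne _)]
        push_cast
        rw [← h6]
        linear_combination e5
  obtain ⟨hdl, _, hpl⟩ := key ℓ le_rfl
  obtain ⟨hdl1, ⟨hA1, -, hB0, -⟩, -⟩ := key (ℓ - 1) (by omega)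
  have e1 : ((ℓ - 1 : ℕ) : ℤ) = (ℓ : ℤ) - 1 := by omega
  have e2 : (ℓ : ℤ) - 1 - 1 = ℓ - 2 := by ring
  rw [e1, e2] at hdl1
  rw [e1] at hA1 hB0
  have p1 : (-1 : ℤ) ^ ℓ = 1 := Even.neg_one_pow (Nat.even_iff.2 hev)
  have p2 : (-1 : ℤ) ^ (ℓ - 1) = -1 := Odd.neg_one_pow (Nat.odd_iff.2 (by omega))
  have p3 : (-1 : ℝ) ^ ((ℓ : ℤ) - 2 + 1) = -1 :=
    Odd.neg_one_zpow (Int.odd_iff.2 (by omega))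
  rw [p1] at hdl
  rw [p2] at hdl1
  rw [Nat.sub_self, hw0] at hpl
  have r1 := congrArg ι hpl
  have r2 := congrArg (fun x => ι (conj x)) hpl
  simp only [map_add, map_mul, map_intCast] at r1 r2
  have hdlR : ((β ((ℓ : ℤ) - 1) : ℤ) : ℝ) * ((α ℓ : ℤ) : ℝ)
      - ((α ((ℓ : ℤ) - 1) : ℤ) : ℝ) * ((β ℓ : ℤ) : ℝ) = 1 := by exact_mod_cast hdl
  set A := α ((ℓ : ℤ) - 1) with hA
  set B := β ((ℓ : ℤ) - 1) with hB
  set v := α ((ℓ : ℤ) - 2) with hv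
  have hnorm : ((A : ℝ) * ι ω + B) * (A * ι (conj ω) + B) = 1 := by
    have hne : ι ω - ι (conj ω) ≠ 0 := by linarith
    apply mul_right_cancel₀ hne
    linear_combination (-((A : ℝ) * ι (conj ω) + B)) * r1 + ((A : ℝ) * ι ω + B) * r2
      + (ι ω - ι (conj ω)) * hdlR
  have hAR : (1 : ℝ) ≤ A := by exact_mod_cast hA1
  have hBR : (0 : ℝ) ≤ B := by exact_mod_cast hB0
  have hε : 0 < (A : ℝ) * ι ω + B := by
    have : 0 < (A : ℝ) * ι ω := mul_pos (by linarith) (by linarith)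
    linarith
  have hε' : 0 < (A : ℝ) * ι (conj ω) + B := by
    by_contra hcon
    push Not at hcon
    have := mul_nonpos_of_nonneg_of_nonpos hε.le hcon
    linarith
  have hN : (0 : ℝ) < (Ideal.absNorm 𝔟 : ℝ) := by
    have : Ideal.absNorm 𝔟 ≠ 0 := fun h => h𝔟 (Ideal.absNorm_eq_zero_iff.1 h)
    exact_mod_cast Nat.pos_of_ne_zero this
  have hpoly : (-(MvPolynomial.C ((a 0 * A : ℤ) : ℝ)) *
          (∑ j ∈ Finset.range (2 * k + 1),
            (MiPoly α β ((ℓ : ℤ) - 1) (-2)) ^ j * (MiPoly α β ((ℓ : ℤ) - 1) 0) ^ (2 * k - j)) *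
          MvPolynomial.X 0 * MvPolynomial.X 1
        - MvPolynomial.X 0 * (MiPoly α β ((ℓ : ℤ) - 1) 0) ^ (2 * k + 1)
        + MvPolynomial.X 1 * (MiPoly α β ((ℓ : ℤ) - 1) ((ℓ : ℤ) - 2)) ^ (2 * k + 1)) =
      -(MvPolynomial.X 0 * (MvPolynomial.C ((a 0 * A + B : ℤ) : ℝ) * MvPolynomial.X 1
          - MvPolynomial.X 0) ^ (2 * k + 1))
        + MvPolynomial.X 1 * (MvPolynomial.X 1 - MvPolynomial.C (v : ℝ) * MvPolynomial.X 0)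
          ^ (2 * k + 1) := by
    have m0 : MiPoly α β ((ℓ : ℤ) - 1) 0 =
        MvPolynomial.C (B : ℝ) * MvPolynomial.X 1 - MvPolynomial.X 0 := by
      simp [MiPoly, hα0, hβ0, ← hA, ← hB]; ring
    have m2 : MiPoly α β ((ℓ : ℤ) - 1) (-2) =
        MvPolynomial.C ((a 0 * A + B : ℤ) : ℝ) * MvPolynomial.X 1 - MvPolynomial.X 0 := by
      have : (-1 : ℝ) ^ (-2 + 1 : ℤ) = -1 := by norm_num
      simp only [MiPoly, hαm2, hβm2, ← hA, ← hB, this]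
      simp; ring
    have ml : MiPoly α β ((ℓ : ℤ) - 1) ((ℓ : ℤ) - 2) =
        MvPolynomial.X 1 - MvPolynomial.C (v : ℝ) * MvPolynomial.X 0 := by
      simp only [MiPoly, ← hA, ← hB, ← hv, p3, hdl1]
      simp; ring
    have g := Commute.geom_sum₂_mul (Commute.all (MiPoly α β ((ℓ : ℤ) - 1) (-2))
      (MiPoly α β ((ℓ : ℤ) - 1) 0)) (2 * k + 1)
    have hd : MiPoly α β ((ℓ : ℤ) - 1) (-2) - MiPoly α β ((ℓ : ℤ) - 1) 0 =
        MvPolynomial.C ((a 0 * A : ℤ) : ℝ) * MvPolynomial.X 1 := by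
      rw [m0, m2]; push_cast; simp only [MvPolynomial.C_add, MvPolynomial.C_mul]; ring
    rw [hd] at g
    simp only [Nat.add_sub_cancel_right, add_tsub_cancel_right, Nat.add_sub_cancel,
      show ∀ j, 2 * k + 1 - 1 - j = 2 * k - j from fun j => by omega] at g
    rw [ml, ← m2]
    linear_combination (-MvPolynomial.X 0) * g
  have hcv : (fun h : ℝ × ℝ =>
        ∫ x in sigmaSet (-B, A) (1, 0) h,
          Real.exp (-((Ideal.absNorm 𝔟 : ℝ) * (x.1 * ι ω + x.2) * (x.1 * ι (conj ω) + x.2)))) =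
      fun h => (1 / (A : ℝ)) * JJ ((Ideal.absNorm 𝔟 : ℝ) / (A : ℝ) ^ 2)
        (A * ι ω + B + (A * ι (conj ω) + B)) h := by
    ext h
    exact change_var A B (by omega) _ _ _ hnorm h
  rw [hpoly, hcv, applyDiff_smul, main_JJ _ _ (by positivity) (by positivity)]
  have hF : ∀ x y : ℝ, Real.exp (-((Ideal.absNorm 𝔟 : ℝ) / (A : ℝ) ^ 2 *
      (y ^ 2 + ((A : ℝ) * ι ω + B + (A * ι (conj ω) + B)) * x * y + x ^ 2))) =
      FF ((Ideal.absNorm 𝔟 : ℝ) / (A : ℝ) ^ 2) (A * ι ω + B + (A * ι (conj ω) + B)) 1 x y := by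
    intro x y
    simp only [FF, map_one, one_mul]
  simp only [hF]
  ring

end
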